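/- Creation-operator formula for nonsymmetric q-Hermite polynomials: Ē_n = q^{n²/4} · X̃ⁿ(1) for every n ≥ 0, and Ē_{−n} = q^{n²/4} · ( X̃ⁿ(1) + (X̃′)ⁿ(1) ) for every n ≥ 1, where X̃ⁿ and (X̃′)ⁿ denote n-fold composition of the operators X̃ and X̃′ applied to the constant Laurent polynomial 1. -/

import Mathlib

/-!
Nonsymmetric continuous q-Hermite polynomials of type A₁ over `K = ℚ(u)`, `q = u⁴`,
together with the nil-Dunkl operators.  The Laurent polynomials `K[X,X⁻¹]` are regarded
inside the ambient field `MK = K(X)`, in which all the operators are given by the same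
formulas (the division by `1 - X²` is then unproblematic).
-/

noncomputable section

/-- The ground field `K = ℚ(u)`. -/
abbrev K : Type := RatFunc ℚ

/-- `u`, with `q = u⁴` (so `u = q^{1/4}`). -/
def u : K := RatFunc.X

/-- `q = u⁴`. -/
def q : K := u ^ 4

/-- The ambient field `K(X)` containing the Laurent polynomials `K[X,X⁻¹]`. -/
abbrev MK : Type := RatFunc K

/-- The variable `X`. -/
def XM : MK := RatFunc.X

/-- The involution `s : Xⁿ ↦ X⁻ⁿ` (the substitution `X ↦ X⁻¹`). -/
def sOp : MK → MK := RatFunc.eval RatFunc.C (XM⁻¹)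

/-- The operator `π : Xⁿ ↦ q^{n/2}X⁻ⁿ` (the substitution `X ↦ q^{1/2}X⁻¹`). -/
def piOp : MK → MK := RatFunc.eval RatFunc.C (RatFunc.C (u ^ 2) * XM⁻¹)

/-- The nil-Hecke operator `T̄(f) = (s(f) - f)/(1 - X²)`. -/
def Tbar (f : MK) : MK := (sOp f - f) / (1 - XM ^ 2)

/-- The nil-Dunkl operator `Ȳ = π ∘ T̄`. -/
def Ybar (f : MK) : MK := piOp (Tbar f)

/-- The operator `Ȳ'(f) = T̄(π(f)) + π(f)`. -/
def Ybar' (f : MK) : MK := Tbar (piOp f) + piOp f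

/-- `∏_{i=0}^{j-1}(1-q^{n-i-1})/(1-q^{1+i})`. -/
def hermProdPos (n j : ℕ) : K :=
  ∏ i ∈ Finset.range j, (1 - q ^ ((n : ℤ) - i - 1)) / (1 - q ^ ((i : ℤ) + 1))

/-- `∏_{i=0}^{j-1}(1-q^{n-i})/(1-q^{1+i})`. -/
def hermProdNeg (n j : ℕ) : K :=
  ∏ i ∈ Finset.range j, (1 - q ^ ((n : ℤ) - i)) / (1 - q ^ ((i : ℤ) + 1))

/-- `Ē_n` for `n ≥ 1`. -/
def EHpos (n : ℕ) : MK :=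
  XM ^ (n : ℤ)
    + ∑ j ∈ Finset.Icc 1 (n / 2),
        RatFunc.C (q ^ ((n : ℤ) - j) * (1 - q ^ (j : ℤ)) / (1 - q ^ ((n : ℤ) - j)) *
          hermProdPos n j) * XM ^ (2 * (j : ℤ) - n)
    + ∑ j ∈ Finset.Icc 1 ((n - 1) / 2),
        RatFunc.C (q ^ (j : ℤ) * hermProdPos n j) * XM ^ ((n : ℤ) - 2 * j)

/-- `Ē_{-n}` for `n ≥ 1`. -/
def EHneg (n : ℕ) : MK :=
  XM ^ (-(n : ℤ)) + XM ^ (n : ℤ)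
    + ∑ j ∈ Finset.Icc 1 (n / 2), RatFunc.C (hermProdNeg n j) * XM ^ (2 * (j : ℤ) - n)
    + ∑ j ∈ Finset.Icc 1 ((n - 1) / 2), RatFunc.C (hermProdNeg n j) * XM ^ ((n : ℤ) - 2 * j)

/-- The nonsymmetric continuous q-Hermite polynomials `Ē_n`, `n ∈ ℤ`. -/
def EH : ℤ → MK := fun n => if 0 < n then EHpos n.toNat else if n = 0 then 1 else EHneg (-n).toNat
/-- The creation operator `X̃(f) = q^{1/4}·Ȳ(X·f)`. -/
def Xtilde (f : MK) : MK := RatFunc.C u * Ybar (XM * f)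

/-- The creation operator `X̃′(f) = q^{-1/4}·X⁻¹·Ȳ'(f)`. -/
def Xtilde' (f : MK) : MK := RatFunc.C u⁻¹ * (XM⁻¹ * Ybar' f)


/-! ### Auxiliary material -/

lemma alg_C (c : K) : IsAlgebraic K (RatFunc.C c : MK) := by
  rw [← RatFunc.algebraMap_eq_C]; exact isAlgebraic_algebraMap c

lemma XM_tr : Transcendental K XM := RatFunc.transcendental_X

lemma XM_ne : XM ≠ 0 := RatFunc.X_ne_zero

lemma u_ne : u ≠ 0 := RatFunc.X_ne_zero

lemma XM_sq_ne (c : K) : XM ^ 2 ≠ RatFunc.C c := by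
  intro h
  have h1 : IsAlgebraic K (XM ^ 2) := h ▸ alg_C c
  exact XM_tr (h1.of_pow (by norm_num))

lemma q_pow_ne (m : ℕ) (hm : 1 ≤ m) : 1 - q ^ m ≠ 0 := by
  intro h
  have h1 : u ^ (4 * m) = 1 := by rw [pow_mul]; exact (sub_eq_zero.mp h).symm
  have h2 : (Polynomial.X : Polynomial ℚ) ^ (4 * m) = 1 := by
    apply RatFunc.algebraMap_injective ℚ
    rw [map_pow, RatFunc.algebraMap_X, map_one]
    exact h1
  have h3 := congrArg Polynomial.natDegree h2
  rw [Polynomial.natDegree_X_pow, Polynomial.natDegree_one] at h3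
  omega

lemma subst_tr (c : K) (hc : c ≠ 0) : Transcendental K (RatFunc.C c * XM⁻¹ : MK) := by
  intro h
  have h1 : IsAlgebraic K ((RatFunc.C c)⁻¹ * (RatFunc.C c * XM⁻¹) : MK)⁻¹ :=
    ((alg_C c).inv.mul h).inv
  have hC : (RatFunc.C c : MK) ≠ 0 := by simpa using hc
  rw [inv_mul_cancel_left₀ hC, inv_inv] at h1
  exact XM_tr h1

lemma eval2_ne (a : MK) (ha : Transcendental K a) (p : Polynomial K) (hp : p ≠ 0) :
    Polynomial.eval₂ RatFunc.C a p ≠ 0 := by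
  intro h
  apply ha
  refine ⟨p, hp, ?_⟩
  rw [Polynomial.aeval_def, RatFunc.algebraMap_eq_C]
  exact h

/-- Substitution of a transcendental element as a ring homomorphism. -/
def substHom (a : MK) (ha : Transcendental K a) : MK →+* MK where
  toFun := RatFunc.eval RatFunc.C a
  map_zero' := RatFunc.eval_zero _ _
  map_one' := RatFunc.eval_one _ _
  map_add' x y := RatFunc.eval_add _ _ (eval2_ne a ha _ (RatFunc.denom_ne_zero x))
    (eval2_ne a ha _ (RatFunc.denom_ne_zero y))
  map_mul' x y := RatFunc.eval_mul _ _ (eval2_ne a ha _ (RatFunc.denom_ne_zero x))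
    (eval2_ne a ha _ (RatFunc.denom_ne_zero y))

lemma substHom_C (a : MK) (ha : Transcendental K a) (c : K) :
    substHom a ha (RatFunc.C c) = RatFunc.C c := RatFunc.eval_C _ _

lemma substHom_X (a : MK) (ha : Transcendental K a) :
    substHom a ha XM = a := RatFunc.eval_X _ _

lemma exists_sOp : ∃ φ : MK →+* MK, (∀ f, sOp f = φ f) ∧ (∀ c, φ (RatFunc.C c) = RatFunc.C c) ∧
    φ XM = XM⁻¹ := by
  have h : Transcendental K (XM⁻¹) := by
    simpa using subst_tr 1 one_ne_zero
  exact ⟨substHom _ h, fun f => rfl, substHom_C _ h, substHom_X _ h⟩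

lemma exists_piOp : ∃ φ : MK →+* MK, (∀ f, piOp f = φ f) ∧
    (∀ c, φ (RatFunc.C c) = RatFunc.C c) ∧ φ XM = RatFunc.C (u ^ 2) * XM⁻¹ := by
  have h := subst_tr (u ^ 2) (pow_ne_zero _ u_ne)
  exact ⟨substHom _ h, fun f => rfl, substHom_C _ h, substHom_X _ h⟩

/-- Gaussian binomials. -/
lemma gb_succ_right (n k : ℕ) :
    hermProdNeg n (k + 1) * (1 - q ^ (k + 1)) = hermProdNeg n k * (1 - q ^ ((n : ℤ) - k)) := by
  have h := q_pow_ne (k + 1) (by omega)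
  have e : q ^ ((k : ℤ) + 1) = q ^ (k + 1) := by exact_mod_cast zpow_natCast q (k + 1)
  unfold hermProdNeg
  rw [Finset.prod_range_succ, e]
  field_simp

lemma gb_succ_succ (n k : ℕ) :
    hermProdNeg (n + 1) (k + 1) * (1 - q ^ (k + 1)) = hermProdNeg n k * (1 - q ^ (n + 1)) := by
  have h := q_pow_ne (k + 1) (by omega)
  have e : q ^ ((k : ℤ) + 1) = q ^ (k + 1) := by exact_mod_cast zpow_natCast q (k + 1)
  have e2 : q ^ ((n : ℤ) + 1) = q ^ (n + 1) := by exact_mod_cast zpow_natCast q (n + 1)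
  unfold hermProdNeg
  rw [Finset.prod_div_distrib, Finset.prod_div_distrib, Finset.prod_range_succ',
    Finset.prod_range_succ (n := k)]
  have e3 : ∀ i ∈ Finset.range k, (1 - q ^ (((n + 1 : ℕ) : ℤ) - ((i + 1 : ℕ) : ℤ))) =
      (1 - q ^ ((n : ℤ) - i)) := by
    intro i _
    congr 2
    push_cast
    ring
  rw [Finset.prod_congr rfl e3, e]
  have e4 : q ^ (((n + 1 : ℕ) : ℤ) - ((0 : ℕ) : ℤ)) = q ^ (n + 1) := by
    rw [Nat.cast_zero, sub_zero, zpow_natCast]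
  rw [e4]
  have hp : ∏ x ∈ Finset.range k, (1 - q ^ ((x : ℤ) + 1)) ≠ 0 := by
    rw [Finset.prod_ne_zero_iff]
    intro i _
    have e : q ^ ((i : ℤ) + 1) = q ^ (i + 1) := by exact_mod_cast zpow_natCast q (i + 1)
    rw [e]
    exact q_pow_ne (i + 1) (by omega)
  field_simp

lemma gb_zero (n : ℕ) : hermProdNeg n 0 = 1 := by simp [hermProdNeg]

lemma q_ne : q ≠ 0 := pow_ne_zero _ u_ne

lemma gb_pascal (n k : ℕ) :
    hermProdNeg (n + 1) (k + 1) = hermProdNeg n k + q ^ (k + 1) * hermProdNeg n (k + 1) := by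
  have h := q_pow_ne (k + 1) (by omega)
  apply mul_right_cancel₀ h
  rw [gb_succ_succ, add_mul, mul_assoc, gb_succ_right]
  have e : q ^ (n + 1) = q ^ (k + 1) * q ^ ((n : ℤ) - k) := by
    rw [← zpow_natCast, ← zpow_natCast, ← zpow_add₀ q_ne]
    congr 1
    push_cast
    ring
  rw [e]
  ring

lemma gb_top (n : ℕ) : hermProdNeg n (n + 1) = 0 := by
  unfold hermProdNeg
  rw [Finset.prod_range_succ]
  simp

lemma gb_prod (a b : ℕ) :
    hermProdNeg (a + b) a * ((∏ i ∈ Finset.range a, (1 - q ^ (i + 1))) *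
      (∏ i ∈ Finset.range b, (1 - q ^ (i + 1)))) = ∏ i ∈ Finset.range (a + b), (1 - q ^ (i + 1)) := by
  induction a with
  | zero => simp [gb_zero]
  | succ a ih =>
    have e : a + 1 + b = (a + b) + 1 := by ring
    rw [e, Finset.prod_range_succ, Finset.prod_range_succ (n := a + b), ← ih]
    linear_combination ((∏ i ∈ Finset.range a, (1 - q ^ (i + 1))) *
      (∏ i ∈ Finset.range b, (1 - q ^ (i + 1)))) * gb_succ_succ (a + b) a

lemma gb_symm (a b : ℕ) : hermProdNeg (a + b) a = hermProdNeg (a + b) b := by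
  have hp : ∀ k, ∏ i ∈ Finset.range k, (1 - q ^ (i + 1)) ≠ 0 := by
    intro k
    rw [Finset.prod_ne_zero_iff]
    exact fun i _ => q_pow_ne (i + 1) (by omega)
  apply mul_right_cancel₀ (mul_ne_zero (hp a) (hp b))
  have h2 := gb_prod b a
  rw [gb_prod, add_comm a b, ← h2]
  ring

lemma pos_eq_neg (n j : ℕ) : hermProdPos (n + 1) j = hermProdNeg n j := by
  unfold hermProdPos hermProdNeg
  refine Finset.prod_congr rfl fun i _ => ?_
  congr 3
  push_cast
  ring

/-- The Rogers polynomials. -/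
def HR (n : ℕ) (z : MK) : MK :=
  ∑ k ∈ Finset.range (n + 1), RatFunc.C (hermProdNeg n k) * z ^ ((n : ℤ) - 2 * k)

lemma map_HR (φ : MK →+* MK) (h : ∀ c, φ (RatFunc.C c) = RatFunc.C c) (n : ℕ) (z : MK) :
    φ (HR n z) = HR n (φ z) := by
  simp [HR, map_sum, h]

lemma HR_zero (z : MK) : HR 0 z = 1 := by simp [HR, gb_zero]

/-- `q^{1/2}` in `K(X)`. -/
def vM : MK := RatFunc.C (u ^ 2)

lemma vM_ne : vM ≠ 0 := by simpa [vM] using u_ne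

lemma C_q : (RatFunc.C q : MK) = vM ^ 2 := by
  rw [vM, ← map_pow, q, ← pow_mul]

lemma HR_shift (n : ℕ) (z : MK) (hz : z ≠ 0) :
    vM ^ n * z * HR n (z / vM) =
      ∑ k ∈ Finset.range (n + 1),
        RatFunc.C (q ^ k * hermProdNeg n k) * z ^ ((n : ℤ) + 1 - 2 * k) := by
  rw [HR, Finset.mul_sum]
  refine Finset.sum_congr rfl fun k _ => ?_
  rw [map_mul, map_pow, C_q, div_zpow, add_sub_right_comm, zpow_add₀ hz, zpow_one,
    zpow_sub₀ vM_ne, zpow_natCast, ← pow_mul]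
  have : vM ^ (2 * (k : ℤ)) = vM ^ (2 * k) := by exact_mod_cast zpow_natCast vM (2 * k)
  rw [this]
  have := vM_ne
  field_simp

lemma HR_rel1 (n : ℕ) (z : MK) (hz : z ≠ 0) :
    HR (n + 1) z = z⁻¹ * HR n z + vM ^ n * z * HR n (z / vM) := by
  rw [HR_shift n z hz]
  have e1 : ∑ k ∈ Finset.range (n + 1),
        (RatFunc.C (q ^ k * hermProdNeg n k) : MK) * z ^ ((n : ℤ) + 1 - 2 * k) =
      ∑ k ∈ Finset.range (n + 2),
        (RatFunc.C (q ^ k * hermProdNeg n k) : MK) * z ^ ((n : ℤ) + 1 - 2 * k) := by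
    rw [Finset.sum_range_succ (n := n + 1), gb_top]
    simp
  rw [e1, Finset.sum_range_succ', HR, Finset.sum_range_succ', HR, Finset.mul_sum, ← add_assoc,
    ← Finset.sum_add_distrib]
  congr 1
  · refine Finset.sum_congr rfl fun k _ => ?_
    rw [gb_pascal, map_add, add_mul]
    congr 1
    · rw [mul_left_comm, ← zpow_neg_one, ← zpow_add₀ hz]
      congr 2
      push_cast
      ring
  · simp [gb_zero]

lemma HR_rel2 (n : ℕ) : ∀ (z : MK), z ≠ 0 →
    HR (n + 1) z = z * HR n z + vM ^ n * z⁻¹ * HR n (vM * z) := by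
  have hv := vM_ne
  induction n with
  | zero =>
    intro z hz
    rw [HR_rel1 0 z hz]
    simp [HR_zero]
    ring
  | succ n ih =>
    intro z hz
    have e1 : vM * z / vM = z := by field_simp
    have e2 : vM * (z / vM) = z := by field_simp
    rw [HR_rel1 (n + 1) z hz, ih (z / vM) (div_ne_zero hz hv),
      HR_rel1 n (vM * z) (mul_ne_zero hv hz), e1, e2]
    conv_lhs => rw [ih z hz]
    conv_rhs => rw [HR_rel1 n z hz]
    field_simp
    ring

lemma HR_symm (n : ℕ) : ∀ (z : MK), z ≠ 0 → HR n z⁻¹ = HR n z := by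
  induction n with
  | zero => intro z _; simp [HR_zero]
  | succ n ih =>
    intro z hz
    rw [HR_rel1 n _ (inv_ne_zero hz), HR_rel2 n z hz, ih z hz]
    have : z⁻¹ / vM = (vM * z)⁻¹ := by
      rw [mul_inv]; ring
    rw [this, ih _ (mul_ne_zero vM_ne hz), inv_inv]

lemma HR_main (n : ℕ) (z : MK) (hz : z ≠ 0) :
    (z - z⁻¹) * HR (n + 1) z =
      vM ^ n * (z ^ 2 * HR n (z / vM) - (z⁻¹) ^ 2 * HR n (vM * z)) := by
  rw [sub_mul]
  nth_rewrite 1 [HR_rel1 n z hz]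
  rw [HR_rel2 n z hz]
  field_simp
  ring

lemma sum_split (f : ℕ → MK) (n : ℕ) (hn : 1 ≤ n) :
    ∑ k ∈ Finset.range n, f k = f 0 + ∑ j ∈ Finset.Icc 1 (n / 2), f (n - j) +
      ∑ j ∈ Finset.Icc 1 ((n - 1) / 2), f j := by
  have hI : ∀ (m : ℕ) (g : ℕ → MK), ∑ j ∈ Finset.Icc 1 m, g j =
      ∑ j ∈ Finset.range m, g (j + 1) := by
    intro m g
    rw [Finset.range_eq_Ico, Finset.sum_Ico_add' g 0 m 1]
    rfl
  have e : n = ((n - 1) / 2 + 1) + n / 2 := by omega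
  rw [hI, hI]
  conv_lhs => rw [e]
  rw [Finset.sum_range_add, Finset.sum_range_succ',
    ← Finset.sum_range_reflect (fun x => f ((n - 1) / 2 + 1 + x))]
  have : ∀ j ∈ Finset.range (n / 2), f ((n - 1) / 2 + 1 + (n / 2 - 1 - j)) = f (n - (j + 1)) := by
    intro j hj
    rw [Finset.mem_range] at hj
    congr 1
    omega
  rw [Finset.sum_congr rfl this]
  ring

lemma EHneg_eq (n : ℕ) (hn : 1 ≤ n) : EHneg n = HR n XM := by
  rw [HR, Finset.sum_range_succ, sum_split _ n hn, EHneg]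
  have h1 : ∀ j ∈ Finset.Icc 1 (n / 2),
      (RatFunc.C (hermProdNeg n (n - j)) : MK) * XM ^ ((n : ℤ) - 2 * ((n - j : ℕ) : ℤ)) =
      RatFunc.C (hermProdNeg n j) * XM ^ (2 * (j : ℤ) - n) := by
    intro j hj
    rw [Finset.mem_Icc] at hj
    obtain ⟨m, rfl⟩ : ∃ m, n = j + m := ⟨n - j, by omega⟩
    rw [Nat.add_sub_cancel_left, gb_symm]
    congr 2
    push_cast
    ring
  rw [Finset.sum_congr rfl h1]
  have h2 : hermProdNeg n n = 1 := by
    have := gb_symm n 0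
    rwa [add_zero, gb_zero] at this
  have h3 : (n : ℤ) - 2 * n = - n := by ring
  rw [h2, h3, gb_zero]
  simp
  ring

lemma EHpos_eq (n : ℕ) : EHpos (n + 1) = vM ^ n * XM * HR n (XM / vM) := by
  rw [HR_shift n XM XM_ne, sum_split _ (n + 1) (by omega), EHpos]
  congr 1
  · congr 1
    · simp [gb_zero]
    · refine Finset.sum_congr rfl fun j hj => ?_
      rw [Finset.mem_Icc] at hj
      obtain ⟨i, rfl⟩ : ∃ i, j = i + 1 := ⟨j - 1, by omega⟩
      obtain ⟨m, rfl⟩ : ∃ m, n = i + (m + 1) := ⟨n - i - 1, by omega⟩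
      have e0 : i + (m + 1) + 1 - (i + 1) = m + 1 := by omega
      have e1 : ((i + (m + 1) + 1 : ℕ) : ℤ) - ((i + 1 : ℕ) : ℤ) = ((m + 1 : ℕ) : ℤ) := by
        push_cast; ring
      rw [e0, e1, pos_eq_neg, zpow_natCast, zpow_natCast]
      have h := gb_succ_right (i + (m + 1)) i
      have e2 : ((i + (m + 1) : ℕ) : ℤ) - (i : ℤ) = ((m + 1 : ℕ) : ℤ) := by
        push_cast; ring
      rw [e2, zpow_natCast, gb_symm] at h
      have hm := q_pow_ne (m + 1) (by omega)
      congr 2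
      · field_simp
        linear_combination q ^ (m + 1) * h
      · push_cast
        ring
  · refine Finset.sum_congr rfl fun j hj => ?_
    rw [pos_eq_neg, zpow_natCast]
    push_cast
    rfl

lemma C_u2 : (RatFunc.C (u ^ 2) : MK) = vM := rfl

lemma one_sub_ne : (1 : MK) - XM ^ 2 ≠ 0 := by
  intro h
  apply XM_sq_ne 1
  rw [map_one]
  exact (sub_eq_zero.mp h).symm

lemma one_sub_ne' : (1 : MK) - (vM * XM⁻¹) ^ 2 ≠ 0 := by
  intro h
  apply XM_sq_ne q
  have hX := XM_ne
  rw [C_q]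
  field_simp at h
  linear_combination h

lemma Xtilde_formula (f g h : MK) (hg : piOp f = g) (hh : piOp (sOp f) = h) :
    Xtilde f = RatFunc.C u * ((XM / vM * h - vM / XM * g) / (1 - (vM * XM⁻¹) ^ 2)) := by
  obtain ⟨s, hs, hsC, hsX⟩ := exists_sOp
  obtain ⟨p, hp, hpC, hpX⟩ := exists_piOp
  rw [hp] at hg
  rw [hp, hs] at hh
  rw [Xtilde, Ybar, Tbar, hs, hp]
  simp only [map_div₀, map_sub, map_mul, map_pow, map_one, hsX, hpX, hg, hh, map_inv₀]
  rw [← map_pow, C_u2]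
  congr 3
  · rw [mul_inv, inv_inv]
    ring
  · rw [div_eq_mul_inv]

lemma Xtilde'_formula (f g h : MK) (hg : piOp f = g) (hh : sOp g = h) :
    Xtilde' f = RatFunc.C u⁻¹ * (XM⁻¹ * ((h - XM ^ 2 * g) / (1 - XM ^ 2))) := by
  rw [Xtilde', Ybar', Tbar, hg, hh]
  have := one_sub_ne
  congr 2
  field_simp
  ring

lemma op_smul (c : K) (f : MK) : Xtilde (RatFunc.C c * f) = RatFunc.C c * Xtilde f := by
  obtain ⟨s, hs, hsC, hsX⟩ := exists_sOp
  obtain ⟨p, hp, hpC, hpX⟩ := exists_piOp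
  rw [Xtilde_formula _ _ _ rfl rfl, Xtilde_formula f _ _ rfl rfl]
  simp only [hs, hp, map_mul, hsC, hpC]
  ring

lemma op_smul' (c : K) (f : MK) : Xtilde' (RatFunc.C c * f) = RatFunc.C c * Xtilde' f := by
  obtain ⟨s, hs, hsC, hsX⟩ := exists_sOp
  obtain ⟨p, hp, hpC, hpX⟩ := exists_piOp
  rw [Xtilde'_formula _ _ _ rfl rfl, Xtilde'_formula f _ _ rfl rfl]
  simp only [hs, hp, map_mul, hsC, hpC]
  ring

lemma uM_ne : (RatFunc.C u : MK) ≠ 0 := by simpa using u_ne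

lemma vM_eq : vM = (RatFunc.C u : MK) ^ 2 := by rw [vM, map_pow]

lemma Xtilde_one : Xtilde 1 = RatFunc.C u⁻¹ * XM := by
  obtain ⟨s, hs, hsC, hsX⟩ := exists_sOp
  obtain ⟨p, hp, hpC, hpX⟩ := exists_piOp
  rw [Xtilde_formula 1 1 1 (by rw [hp, map_one]) (by rw [hp, hs, map_one, map_one])]
  have h := one_sub_ne'
  have h1 := uM_ne
  have h2 := XM_ne
  have h3 := vM_ne
  rw [mul_div_assoc', div_eq_iff h, vM_eq, map_inv₀]
  field_simp

lemma Xtilde'_one : Xtilde' 1 = RatFunc.C u⁻¹ * XM⁻¹ := by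
  obtain ⟨s, hs, hsC, hsX⟩ := exists_sOp
  obtain ⟨p, hp, hpC, hpX⟩ := exists_piOp
  rw [Xtilde'_formula 1 1 1 (by rw [hp, map_one]) (by rw [hs, map_one])]
  rw [mul_one, div_self one_sub_ne, mul_one]

lemma Xtilde_step (n : ℕ) :
    RatFunc.C (u ^ (2 * n + 3)) * Xtilde (vM ^ n * XM * HR n (XM / vM)) =
      vM ^ (n + 1) * XM * HR (n + 1) (XM / vM) := by
  obtain ⟨s, hs, hsC, hsX⟩ := exists_sOp
  obtain ⟨p, hp, hpC, hpX⟩ := exists_piOp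
  have hX := XM_ne
  have hv := vM_ne
  have hsv : s vM = vM := hsC _
  have hpv : p vM = vM := hpC _
  rw [C_u2] at hpX
  have a1 : p (vM ^ n * XM * HR n (XM / vM)) = vM ^ n * (vM * XM⁻¹) * HR n XM := by
    rw [map_mul, map_mul, map_pow, hpv, hpX, map_HR p hpC, map_div₀, hpX, hpv, ← HR_symm n XM hX]
    congr 2
    field_simp
  have a2 : p (s (vM ^ n * XM * HR n (XM / vM))) =
      vM ^ n * (XM / vM) * HR n (XM / vM / vM) := by
    have : p (s XM) = XM / vM := by
      rw [hsX, map_inv₀, hpX]; field_simp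
    rw [map_mul, map_mul, map_mul, map_mul, map_pow, map_pow, hsv, hpv, this, map_HR s hsC,
      map_HR p hpC, map_div₀, map_div₀, this, hsv, hpv]
  have a3 : piOp (sOp (vM ^ n * XM * HR n (XM / vM))) =
      vM ^ n * (XM / vM) * HR n (XM / vM / vM) := by
    rw [hp, hs]; exact a2
  rw [Xtilde_formula _ _ _ ((hp _).trans a1) a3]
  have h := one_sub_ne'
  have hm := HR_main n (XM / vM) (div_ne_zero hX hv)
  have e : vM * (XM / vM) = XM := by field_simp
  rw [e] at hm
  have e3 : (RatFunc.C (u ^ (2 * n + 3)) : MK) * RatFunc.C u = vM ^ (n + 2) := by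
    rw [vM_eq, ← map_mul, ← map_pow, ← map_pow]
    congr 1
    ring
  rw [← mul_assoc, e3, mul_div_assoc', div_eq_iff h]
  have e4 : (1 : MK) - (vM * XM⁻¹) ^ 2 = (XM / vM - (XM / vM)⁻¹) * (vM / XM) := by
    field_simp
  rw [e4]
  calc _ = vM ^ (n + 1) * XM * (vM / XM) *
        (vM ^ n * ((XM / vM) ^ 2 * HR n (XM / vM / vM) - ((XM / vM)⁻¹) ^ 2 * HR n XM)) := by
        generalize HR n (XM / vM / vM) = A
        generalize HR n XM = B
        field_simp
        ring
    _ = _ := by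
        rw [← hm]; ring

lemma Xtilde'_step (n : ℕ) :
    RatFunc.C (u ^ (2 * n + 3)) * Xtilde' (XM⁻¹ * HR n XM) = XM⁻¹ * HR (n + 1) XM := by
  obtain ⟨s, hs, hsC, hsX⟩ := exists_sOp
  obtain ⟨p, hp, hpC, hpX⟩ := exists_piOp
  have hX := XM_ne
  have hv := vM_ne
  have hsv : s vM = vM := hsC _
  rw [C_u2] at hpX
  have a1 : p (XM⁻¹ * HR n XM) = XM / vM * HR n (XM / vM) := by
    have e : (vM * XM⁻¹)⁻¹ = XM / vM := by rw [mul_inv, inv_inv]; ring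
    rw [map_mul, map_inv₀, map_HR p hpC, hpX, ← HR_symm n _ (mul_ne_zero hv (inv_ne_zero hX)), e]
  have a2 : s (XM / vM * HR n (XM / vM)) = XM⁻¹ / vM * HR n (vM * XM) := by
    have e : (vM * XM)⁻¹ = XM⁻¹ / vM := by rw [mul_inv]; ring
    rw [map_mul, map_HR s hsC, map_div₀, hsX, hsv, ← HR_symm n _ (mul_ne_zero hv hX), e]
  rw [Xtilde'_formula _ _ _ ((hp _).trans a1) ((hs _).trans a2)]
  have h := one_sub_ne
  have hm := HR_main n XM hX
  have e3 : (RatFunc.C (u ^ (2 * n + 3)) : MK) * RatFunc.C u⁻¹ = vM ^ (n + 1) := by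
    rw [vM_eq, ← map_mul, ← map_pow, ← map_pow]
    congr 1
    have := u_ne
    field_simp
    ring
  rw [← mul_assoc, e3, mul_div_assoc', mul_div_assoc', div_eq_iff h]
  have e4 : (1 : MK) - XM ^ 2 = (XM - XM⁻¹) * (- XM) := by
    field_simp
    ring
  rw [e4]
  calc _ = - (vM ^ n * (XM ^ 2 * HR n (XM / vM) - (XM⁻¹) ^ 2 * HR n (vM * XM))) := by
        generalize HR n (XM / vM) = A
        generalize HR n (vM * XM) = B
        field_simp
        ring
    _ = _ := by
        rw [← hm]
        field_simp

lemma Xtilde_iter (n : ℕ) :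
    vM ^ n * XM * HR n (XM / vM) = RatFunc.C (u ^ ((n + 1) ^ 2)) * (Xtilde^[n + 1] 1) := by
  induction n with
  | zero =>
    have := uM_ne
    simp [HR_zero, Xtilde_one, this]
  | succ n ih =>
    rw [Function.iterate_succ_apply', ← Xtilde_step, ih, op_smul, ← mul_assoc, ← map_mul,
      ← pow_add]
    congr 3
    ring

lemma Xtilde'_iter (n : ℕ) :
    XM⁻¹ * HR n XM = RatFunc.C (u ^ ((n + 1) ^ 2)) * (Xtilde'^[n + 1] 1) := by
  induction n with
  | zero =>
    have := uM_ne
    simp [HR_zero, Xtilde'_one, this]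
  | succ n ih =>
    rw [Function.iterate_succ_apply', ← Xtilde'_step, ih, op_smul', ← mul_assoc, ← map_mul,
      ← pow_add]
    congr 3
    ring

/-- Creation-operator formula for nonsymmetric q-Hermite polynomials:
`Ē_n = q^{n²/4}·X̃ⁿ(1)` for every `n ≥ 0`, and
`Ē_{-n} = q^{n²/4}·(X̃ⁿ(1) + (X̃′)ⁿ(1))` for every `n ≥ 1`,
where `X̃ⁿ`, `(X̃′)ⁿ` are `n`-fold compositions applied to `1`
(note `q^{n²/4} = u^{n²}`). -/
theorem hermite_creation_operators :
    (∀ n : ℕ, EH (n : ℤ) = RatFunc.C (u ^ (n ^ 2)) * (Xtilde^[n] 1)) ∧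
    (∀ n : ℕ, 1 ≤ n →
      EH (-(n : ℤ)) = RatFunc.C (u ^ (n ^ 2)) * (Xtilde^[n] 1 + Xtilde'^[n] 1)) := by
  have h1 : ∀ n : ℕ, EH (n : ℤ) = RatFunc.C (u ^ (n ^ 2)) * (Xtilde^[n] 1) := by
    intro n
    cases n with
    | zero => simp [EH]
    | succ n =>
      rw [← Xtilde_iter, ← EHpos_eq, EH]
      have : (0 : ℤ) < ((n + 1 : ℕ) : ℤ) := by positivity
      rw [if_pos this, Int.toNat_natCast]
  refine ⟨h1, fun n hn => ?_⟩
  obtain ⟨m, rfl⟩ : ∃ m, n = m + 1 := ⟨n - 1, by omega⟩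
  rw [mul_add, ← Xtilde_iter, ← Xtilde'_iter, add_comm (vM ^ m * _ * _), ← HR_rel1 m XM XM_ne,
    ← EHneg_eq _ hn, EH]
  rw [if_neg (by omega), if_neg (by omega), neg_neg, Int.toNat_natCast]
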